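/- arXiv:1805.10755 — 2 statements merged into one kernel-verified Lean document; each statement's English description precedes it below -/
import Mathlib

section
/- (Performance Difference Lemma, Lemma 1.) For any two policies π and π', J(π) − J(π') = (1/(1−γ)) · E_{(s,a)∼d_π π}[A^{π'}(s,a)]. -/
open scoped BigOperators

noncomputable section

/-- `p` is a probability distribution on a finite type. -/
def IsDist {X : Type*} [Fintype X] (p : X → ℝ) : Prop :=
  (∀ x, 0 ≤ p x) ∧ ∑ x, p x = 1

/-- `P` is a transition dynamics: `P s a` is a distribution over next states. -/
def IsDynamics {S A : Type*} [Fintype S] (P : S → A → S → ℝ) : Prop :=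
  ∀ s a, IsDist (P s a)

/-- `π` is a (stochastic) policy: `π s` is a distribution over actions. -/
def IsPolicy {S A : Type*} [Fintype A] (π : S → A → ℝ) : Prop :=
  ∀ s, IsDist (π s)

/-- One-step evolution of a state distribution under policy `π` and dynamics `P`. -/
def step {S A : Type*} [Fintype S] [Fintype A]
    (P : S → A → S → ℝ) (π : S → A → ℝ) (d : S → ℝ) : S → ℝ :=
  fun s' => ∑ s, ∑ a, d s * π s a * P s a s'

/-- The time-`t` state distribution `d_π^t` starting from `ρ₀`. -/
def stateDist {S A : Type*} [Fintype S] [Fintype A]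
    (P : S → A → S → ℝ) (π : S → A → ℝ) (ρ₀ : S → ℝ) : ℕ → S → ℝ
  | 0 => ρ₀
  | t + 1 => step P π (stateDist P π ρ₀ t)

/-- Discounted state visitation distribution `d_π = (1-γ) Σ_t γ^t d_π^t`. -/
def visit {S A : Type*} [Fintype S] [Fintype A]
    (γ : ℝ) (P : S → A → S → ℝ) (π : S → A → ℝ) (ρ₀ : S → ℝ) : S → ℝ :=
  fun s => (1 - γ) * ∑' t : ℕ, γ ^ t * stateDist P π ρ₀ t s

/-- Expected cost of one step when the state is distributed as `d` and actions follow `π`. -/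
def expCost {S A : Type*} [Fintype S] [Fintype A]
    (c : S → A → ℝ) (π : S → A → ℝ) (d : S → ℝ) : ℝ :=
  ∑ s, ∑ a, d s * π s a * c s a

/-- Value function `V^π(s₀)`: expected total discounted cost starting at `s₀`. -/
def Vf {S A : Type*} [Fintype S] [Fintype A] [DecidableEq S]
    (γ : ℝ) (P : S → A → S → ℝ) (c : S → A → ℝ) (π : S → A → ℝ) (s₀ : S) : ℝ :=
  ∑' t : ℕ, γ ^ t * expCost c π (stateDist P π (fun s => if s = s₀ then 1 else 0) t)

/-- Objective `J(π) = E_{s∼ρ₀}[V^π(s)]`. -/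
def Jf {S A : Type*} [Fintype S] [Fintype A] [DecidableEq S]
    (γ : ℝ) (P : S → A → S → ℝ) (c : S → A → ℝ) (ρ₀ : S → ℝ) (π : S → A → ℝ) : ℝ :=
  ∑ s, ρ₀ s * Vf γ P c π s

/-- State-action value `Q^π(s,a) = c(s,a) + γ E_{s'∼P_{s,a}}[V^π(s')]`. -/
def Qf {S A : Type*} [Fintype S] [Fintype A] [DecidableEq S]
    (γ : ℝ) (P : S → A → S → ℝ) (c : S → A → ℝ) (π : S → A → ℝ) (s : S) (a : A) : ℝ :=
  c s a + γ * ∑ s', P s a s' * Vf γ P c π s'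

/-- Disadvantage function `A^π(s,a) = Q^π(s,a) - V^π(s)`. -/
def Adv {S A : Type*} [Fintype S] [Fintype A] [DecidableEq S]
    (γ : ℝ) (P : S → A → S → ℝ) (c : S → A → ℝ) (π : S → A → ℝ) (s : S) (a : A) : ℝ :=
  Qf γ P c π s a - Vf γ P c π s

theorem IsDist.step {S A : Type*} [Fintype S] [Fintype A] {P : S → A → S → ℝ} {π : S → A → ℝ}
    (hP : IsDynamics P) (hπ : IsPolicy π) {d : S → ℝ} (hd : IsDist d) :
    IsDist (step P π d) := by
  refine ⟨fun s' => Finset.sum_nonneg fun s _ => Finset.sum_nonneg fun a _ =>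
    mul_nonneg (mul_nonneg (hd.1 s) ((hπ s).1 a)) ((hP s a).1 s'), ?_⟩
  unfold _root_.step
  rw [Finset.sum_comm]
  refine Eq.trans ?_ hd.2
  refine Finset.sum_congr rfl fun s _ => ?_
  rw [Finset.sum_comm]
  simp_rw [← Finset.mul_sum, (hP s _).2, mul_one, ← Finset.mul_sum, (hπ s).2, mul_one]

theorem IsDist.stateDist {S A : Type*} [Fintype S] [Fintype A] {P : S → A → S → ℝ}
    {π : S → A → ℝ} (hP : IsDynamics P) (hπ : IsPolicy π) {ρ : S → ℝ} (hρ : IsDist ρ) (t : ℕ) :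
    IsDist (stateDist P π ρ t) := by
  induction t with
  | zero => exact hρ
  | succ t ih => exact ih.step hP hπ

theorem IsDist.le_one {X : Type*} [Fintype X] {p : X → ℝ} (hp : IsDist p) (x : X) : p x ≤ 1 :=
  (Finset.single_le_sum (f := p) (fun y _ => hp.1 y) (Finset.mem_univ x)).trans_eq hp.2

theorem isDist_pointMass {X : Type*} [Fintype X] [DecidableEq X] (x₀ : X) :
    IsDist (fun x => if x = x₀ then (1 : ℝ) else 0) :=
  ⟨fun x => by dsimp only; split_ifs <;> norm_num, by simp⟩

/-- The state distributions depend linearly on the initial distribution. -/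
theorem stateDist_eq_sum_pointMass {S A : Type*} [Fintype S] [Fintype A] [DecidableEq S]
    (P : S → A → S → ℝ) (π : S → A → ℝ) (ρ : S → ℝ) (t : ℕ) (s : S) :
    stateDist P π ρ t s =
      ∑ x, ρ x * stateDist P π (fun y => if y = x then 1 else 0) t s := by
  induction t generalizing s with
  | zero => simp [stateDist]
  | succ t ih =>
    simp only [stateDist, step, Finset.mul_sum]
    symm
    rw [Finset.sum_comm]
    refine Finset.sum_congr rfl fun r _ => ?_
    rw [Finset.sum_comm]
    refine Finset.sum_congr rfl fun a _ => ?_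
    rw [ih r, Finset.sum_mul, Finset.sum_mul]
    exact Finset.sum_congr rfl fun x _ => by ring

/-- Expectation of `f` after one step, as an expectation before the step. -/
theorem sum_step_mul {S A : Type*} [Fintype S] [Fintype A] (P : S → A → S → ℝ) (π : S → A → ℝ)
    (d f : S → ℝ) :
    ∑ s', step P π d s' * f s' = ∑ s, ∑ a, d s * π s a * ∑ s', P s a s' * f s' := by
  simp only [step, Finset.sum_mul, Finset.mul_sum]
  rw [Finset.sum_comm]
  refine Finset.sum_congr rfl fun s _ => ?_
  rw [Finset.sum_comm]
  exact Finset.sum_congr rfl fun a _ => Finset.sum_congr rfl fun s' _ => by ring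

theorem summable_discounted_stateDist {S A : Type*} [Fintype S] [Fintype A] {γ : ℝ}
    {P : S → A → S → ℝ} {π : S → A → ℝ} {ρ : S → ℝ} (hγ : 0 ≤ γ) (hγ' : γ < 1)
    (hP : IsDynamics P) (hπ : IsPolicy π) (hρ : IsDist ρ) (s : S) :
    Summable fun t : ℕ => γ ^ t * stateDist P π ρ t s :=
  Summable.of_nonneg_of_le
    (fun t => mul_nonneg (pow_nonneg hγ t) ((hρ.stateDist hP hπ t).1 s))
    (fun t => mul_le_of_le_one_right (pow_nonneg hγ t) ((hρ.stateDist hP hπ t).le_one s))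
    (summable_geometric_of_lt_one hγ hγ')

/-- Discounted sums of expectations are expectations under the discounted occupancy measure. -/
theorem hasSum_discounted_expectation {S A : Type*} [Fintype S] [Fintype A] {γ : ℝ}
    {P : S → A → S → ℝ} {π : S → A → ℝ} {ρ : S → ℝ} (hγ : 0 ≤ γ) (hγ' : γ < 1)
    (hP : IsDynamics P) (hπ : IsPolicy π) (hρ : IsDist ρ) (f : S → ℝ) :
    HasSum (fun t : ℕ => γ ^ t * ∑ s, stateDist P π ρ t s * f s)
      (∑ s, (∑' t : ℕ, γ ^ t * stateDist P π ρ t s) * f s) := by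
  have h := hasSum_sum fun s (_ : s ∈ Finset.univ) =>
    (summable_discounted_stateDist hγ hγ' hP hπ hρ s).hasSum.mul_right (f s)
  simpa only [Finset.mul_sum, mul_assoc] using h

theorem expCost_eq_sum {S A : Type*} [Fintype S] [Fintype A] (c π : S → A → ℝ) (d : S → ℝ) :
    expCost c π d = ∑ s, d s * ∑ a, π s a * c s a := by
  simp only [expCost, Finset.mul_sum, mul_assoc]

/-- The objective is the discounted sum of expected costs started from `ρ`. -/
theorem hasSum_Jf {S A : Type*} [Fintype S] [Fintype A] [DecidableEq S] {γ : ℝ}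
    {P : S → A → S → ℝ} {π : S → A → ℝ} (hγ : 0 ≤ γ) (hγ' : γ < 1)
    (hP : IsDynamics P) (hπ : IsPolicy π) (c : S → A → ℝ) (ρ : S → ℝ) :
    HasSum (fun t : ℕ => γ ^ t * expCost c π (stateDist P π ρ t)) (Jf γ P c ρ π) := by
  have h := hasSum_sum fun x (_ : x ∈ Finset.univ) =>
    (hasSum_discounted_expectation hγ hγ' hP hπ (isDist_pointMass x)
      fun s => ∑ a, π s a * c s a).summable.hasSum.mul_left (ρ x)
  simp only [← expCost_eq_sum] at h
  suffices hfun : ∀ t, γ ^ t * expCost c π (stateDist P π ρ t) = ∑ x, ρ x *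
      (γ ^ t * expCost c π (stateDist P π (fun y => if y = x then 1 else 0) t)) by
    simpa only [Jf, Vf, hfun] using h
  intro t
  simp only [expCost_eq_sum]
  simp_rw [stateDist_eq_sum_pointMass P π ρ t, Finset.sum_mul, Finset.mul_sum]
  rw [Finset.sum_comm]
  exact Finset.sum_congr rfl fun x _ => Finset.sum_congr rfl fun s _ =>
    Finset.sum_congr rfl fun a _ => by ring

/-- The expected disadvantage is a one-step temporal difference of the reference values. -/
theorem sum_mul_sum_Adv {S A : Type*} [Fintype S] [Fintype A] [DecidableEq S] {π : S → A → ℝ}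
    (hπ : IsPolicy π) (γ : ℝ) (P : S → A → S → ℝ) (c π' : S → A → ℝ) (d : S → ℝ) :
    ∑ s, d s * ∑ a, π s a * Adv γ P c π' s a =
      expCost c π d + γ * ∑ s, step P π d s * Vf γ P c π' s - ∑ s, d s * Vf γ P c π' s := by
  rw [sum_step_mul, expCost, Finset.mul_sum, ← Finset.sum_add_distrib, ← Finset.sum_sub_distrib]
  refine Finset.sum_congr rfl fun s _ => ?_
  have hV : d s * Vf γ P c π' s = ∑ a, d s * π s a * Vf γ P c π' s := by
    rw [← Finset.sum_mul, ← Finset.mul_sum, (hπ s).2, mul_one]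
  rw [hV, Finset.mul_sum, Finset.mul_sum, ← Finset.sum_add_distrib, ← Finset.sum_sub_distrib]
  refine Finset.sum_congr rfl fun a _ => ?_
  rw [Adv, Qf]
  ring

/-- **Performance Difference Lemma.** For any two policies `π` and `π'`,
`J(π) - J(π') = (1/(1-γ)) * E_{(s,a) ∼ d_π π}[A^{π'}(s,a)]`. -/
theorem performance_difference_lemma
    {S A : Type*} [Fintype S] [Fintype A] [DecidableEq S]
    (γ : ℝ) (P : S → A → S → ℝ) (c : S → A → ℝ) (ρ₀ : S → ℝ)
    (hγ : 0 < γ) (hγ' : γ < 1) (hP : IsDynamics P) (hρ : IsDist ρ₀)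
    (hc : ∀ s a, 0 ≤ c s a ∧ c s a ≤ 1)
    (π π' : S → A → ℝ) (hπ : IsPolicy π) (hπ' : IsPolicy π') :
    Jf γ P c ρ₀ π - Jf γ P c ρ₀ π' =
      (1 / (1 - γ)) * ∑ s, ∑ a, visit γ P π ρ₀ s * π s a * Adv γ P c π' s a := by
  have hγ₀ := hγ.le
  have hne : 1 - γ ≠ 0 := (sub_pos.2 hγ').ne'
  have hA := hasSum_discounted_expectation hγ₀ hγ' hP hπ hρ fun s => ∑ a, π s a * Adv γ P c π' s a
  have hV := (hasSum_discounted_expectation hγ₀ hγ' hP hπ hρ (Vf γ P c π')).summable.hasSum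
  have hV' := (hasSum_nat_add_iff' 1).2 hV
  have hT := ((hasSum_Jf hγ₀ hγ' hP hπ c ρ₀).add hV').sub hV
  have hEq := hA.tsum_eq.symm.trans <| (tsum_congr fun t => by
    rw [sum_mul_sum_Adv hπ, stateDist]
    ring).trans hT.tsum_eq
  have hR : (1 / (1 - γ)) * ∑ s, ∑ a, visit γ P π ρ₀ s * π s a * Adv γ P c π' s a =
      ∑ s, (∑' t : ℕ, γ ^ t * stateDist P π ρ₀ t s) * ∑ a, π s a * Adv γ P c π' s a := by
    simp only [Finset.mul_sum]
    refine Finset.sum_congr rfl fun s _ => Finset.sum_congr rfl fun a _ => ?_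
    rw [visit]
    field_simp
  have hJ : Jf γ P c ρ₀ π' = ∑ s, ρ₀ s * Vf γ P c π' s := rfl
  rw [hR, hEq, hJ]
  simp only [Finset.range_one, Finset.sum_singleton, pow_zero, one_mul, stateDist]
  ring
end
end

section
/- For any two policies π₁ and π₂ and any time step t ≥ 0, the time-t state distributions satisfy Σ_{s∈S} |d_{π₁}^t(s) − d_{π₂}^t(s)| ≤ Σ_{i=0}^{t−1} E_{s∼d_{π₁}^i}[‖π₁(·|s) − π₂(·|s)‖₁]. -/
open scoped BigOperators

noncomputable section

/-- Evolving a state distribution under a policy preserves nonnegativity. -/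
theorem stateDist_nonneg {S A : Type*} [Fintype S] [Fintype A]
    {P : S → A → S → ℝ} {π : S → A → ℝ} {ρ₀ : S → ℝ}
    (hP : IsDynamics P) (hπ : IsPolicy π) (hρ : IsDist ρ₀) (t : ℕ) (s : S) :
    0 ≤ stateDist P π ρ₀ t s := by
  induction t generalizing s with
  | zero => exact hρ.1 s
  | succ t ih =>
    exact Finset.sum_nonneg fun s' _ => Finset.sum_nonneg fun a _ =>
      mul_nonneg (mul_nonneg (ih s') ((hπ s').1 a)) ((hP s' a).1 s)

/-- Pushing a signed state-action weight through the dynamics does not increase its `ℓ¹` norm. -/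
theorem IsDynamics.sum_abs_push_le {S A : Type*} [Fintype S] [Fintype A]
    {P : S → A → S → ℝ} (hP : IsDynamics P) (f : S → A → ℝ) :
    ∑ s', |∑ s, ∑ a, f s a * P s a s'| ≤ ∑ s, ∑ a, |f s a| := by
  calc ∑ s', |∑ s, ∑ a, f s a * P s a s'|
      ≤ ∑ s', ∑ s, ∑ a, |f s a| * P s a s' := by
        refine Finset.sum_le_sum fun s' _ => (Finset.abs_sum_le_sum_abs _ _).trans
          (Finset.sum_le_sum fun s _ => (Finset.abs_sum_le_sum_abs _ _).trans_eq
            (Finset.sum_congr rfl fun a _ => ?_))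
        rw [abs_mul, abs_of_nonneg ((hP s a).1 s')]
    _ = ∑ s, ∑ a, |f s a| := by
        rw [Finset.sum_comm]
        refine Finset.sum_congr rfl fun s _ => ?_
        rw [Finset.sum_comm]
        refine Finset.sum_congr rfl fun a _ => ?_
        rw [← Finset.mul_sum, (hP s a).2, mul_one]

/-- The `ℓ¹` distance after one step is at most the `ℓ¹` distance before it plus the expected
`ℓ¹` distance between the policies. -/
theorem sum_abs_step_sub_step_le {S A : Type*} [Fintype S] [Fintype A]
    {P : S → A → S → ℝ} (hP : IsDynamics P) {π₁ π₂ : S → A → ℝ} (hπ₂ : IsPolicy π₂)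
    {d₁ : S → ℝ} (hd₁ : ∀ s, 0 ≤ d₁ s) (d₂ : S → ℝ) :
    ∑ s, |step P π₁ d₁ s - step P π₂ d₂ s| ≤
      ∑ s, |d₁ s - d₂ s| + ∑ s, d₁ s * ∑ a, |π₁ s a - π₂ s a| := by
  calc ∑ s, |step P π₁ d₁ s - step P π₂ d₂ s|
      = ∑ s', |∑ s, ∑ a, (d₁ s * π₁ s a - d₂ s * π₂ s a) * P s a s'| := by
        simp only [step, sub_mul, Finset.sum_sub_distrib]
    _ ≤ ∑ s, ∑ a, |d₁ s * π₁ s a - d₂ s * π₂ s a| := hP.sum_abs_push_le _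
    _ ≤ ∑ s, ∑ a, (|d₁ s - d₂ s| * π₂ s a + d₁ s * |π₁ s a - π₂ s a|) := by
        refine Finset.sum_le_sum fun s _ => Finset.sum_le_sum fun a _ => ?_
        calc |d₁ s * π₁ s a - d₂ s * π₂ s a|
            = |(d₁ s - d₂ s) * π₂ s a + d₁ s * (π₁ s a - π₂ s a)| := by ring_nf
          _ ≤ |(d₁ s - d₂ s) * π₂ s a| + |d₁ s * (π₁ s a - π₂ s a)| := abs_add_le _ _
          _ = _ := by rw [abs_mul, abs_mul, abs_of_nonneg ((hπ₂ s).1 a), abs_of_nonneg (hd₁ s)]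
    _ = ∑ s, |d₁ s - d₂ s| + ∑ s, d₁ s * ∑ a, |π₁ s a - π₂ s a| := by
        simp only [Finset.sum_add_distrib, ← Finset.mul_sum, (hπ₂ _).2, mul_one]

/-- For any two policies `π₁, π₂` and any time `t`, the time-`t` state distributions satisfy
`Σ_s |d_{π₁}^t(s) - d_{π₂}^t(s)| ≤ Σ_{i=0}^{t-1} E_{s ∼ d_{π₁}^i}[‖π₁(·|s) - π₂(·|s)‖₁]`. -/
theorem stateDist_l1_diff_le
    {S A : Type*} [Fintype S] [Fintype A]
    (P : S → A → S → ℝ) (ρ₀ : S → ℝ)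
    (hP : IsDynamics P) (hρ : IsDist ρ₀)
    (π₁ π₂ : S → A → ℝ) (hπ₁ : IsPolicy π₁) (hπ₂ : IsPolicy π₂) (t : ℕ) :
    ∑ s, |stateDist P π₁ ρ₀ t s - stateDist P π₂ ρ₀ t s| ≤
      ∑ i ∈ Finset.range t, ∑ s, stateDist P π₁ ρ₀ i s * ∑ a, |π₁ s a - π₂ s a| := by
  induction t with
  | zero => simp [stateDist]
  | succ t ih =>
    rw [Finset.sum_range_succ]
    exact (sum_abs_step_sub_step_le hP hπ₂ (stateDist_nonneg hP hπ₁ hρ t) _).trans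
      (add_le_add_left ih _)
end
end
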